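/- Let g = 247L be the 7-dimensional nilpotent real Lie algebra with basis e1,…,e7 and only nonzero brackets [e1,e2] = −e4, [e1,e3] = −e5, [e1,e4] = −e6, [e2,e3] = −e6, [e1,e5] = −e7 (up to antisymmetry). Then: (i) the space of closed alternating 3-forms on g has dimension 23; (ii) the space of derivations of g has dimension 17; (iii) the 3-form φ = e^{123}+e^{126}−e^{137}−e^{145}−2e^{167}+e^{246}−e^{257}+e^{347}+e^{356} is closed and the only derivation of g stabilizing φ is 0. -/

import Mathlib

noncomputable section

/-- The underlying 7-dimensional real vector space. -/
abbrev V : Type := Fin 7 → ℝ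

/-- The Lie bracket of the nilpotent Lie algebra `247L`, extended bilinearly from the structure constants. -/
def bk (x y : V) : V :=
  ![0, 0, 0, -(x 0 * y 1 - x 1 * y 0), -(x 0 * y 2 - x 2 * y 0),
    -(x 0 * y 3 - x 3 * y 0) - (x 1 * y 2 - x 2 * y 1), -(x 0 * y 4 - x 4 * y 0)]

/-- The alternating 3-form `e^i ∧ e^j ∧ e^k` on `V`. -/
def w3 (i j k : Fin 7) : AlternatingMap ℝ V ℝ (Fin 3) :=
  (Matrix.detRowAlternating : AlternatingMap ℝ (Fin 3 → ℝ) ℝ (Fin 3)).compLinearMap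
    (LinearMap.pi (fun a => LinearMap.proj (![i, j, k] a)))

/-- Chevalley–Eilenberg differential of a 3-form, as a scalar-valued function. -/
def d3 (φ : AlternatingMap ℝ V ℝ (Fin 3)) (x₀ x₁ x₂ x₃ : V) : ℝ :=
  -(φ ![bk x₀ x₁, x₂, x₃]) + φ ![bk x₀ x₂, x₁, x₃] - φ ![bk x₀ x₃, x₁, x₂]
    - φ ![bk x₁ x₂, x₀, x₃] + φ ![bk x₁ x₃, x₀, x₂] - φ ![bk x₂ x₃, x₀, x₁]

/-- A 3-form is closed if its Chevalley–Eilenberg differential vanishes. -/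
def Closed3 (φ : AlternatingMap ℝ V ℝ (Fin 3)) : Prop :=
  ∀ x₀ x₁ x₂ x₃ : V, d3 φ x₀ x₁ x₂ x₃ = 0

/-- A linear map `D : V → V` is a derivation of the Lie algebra `(V, bk)`. -/
def IsDeriv (D : V →ₗ[ℝ] V) : Prop :=
  ∀ x y : V, D (bk x y) = bk (D x) y + bk x (D y)

/-- `D` stabilizes (annihilates infinitesimally) the 3-form `φ`. -/
def Stab3 (φ : AlternatingMap ℝ V ℝ (Fin 3)) (D : V →ₗ[ℝ] V) : Prop :=
  ∀ x y z : V, φ ![D x, y, z] + φ ![x, D y, z] + φ ![x, y, D z] = 0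

/-- The distinguished 3-form. -/
def phi : AlternatingMap ℝ V ℝ (Fin 3) :=
  w3 0 1 2 + w3 0 1 5 - w3 0 2 6 - w3 0 3 4 - (2 : ℝ) • w3 0 5 6 + w3 1 3 5 - w3 1 4 6
    + w3 2 3 6 + w3 2 4 5

/-- The standard basis vectors of `V`. -/
abbrev e (i : Fin 7) : V := Pi.single i 1

theorem bk_single_single (i j : Fin 7) (h : i < j) :
    bk (e i) (e j) =
      if i = 0 ∧ j = 1 then -e 3 else if i = 0 ∧ j = 2 then -e 4
      else if i = 0 ∧ j = 3 then -e 5 else if i = 1 ∧ j = 2 then -e 5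
      else if i = 0 ∧ j = 4 then -e 6 else 0 := by
  revert h
  fin_cases i <;> fin_cases j <;> intro h <;> first | (exact absurd h (by decide)) |
    (ext k; fin_cases k <;> simp [bk, e])

section ThreeForms

variable (φ : AlternatingMap ℝ V ℝ (Fin 3)) (x y z : V)

theorem threeForm_zero_left : φ ![0, y, z] = 0 := φ.map_coord_zero 0 rfl

theorem threeForm_neg_left : φ ![-x, y, z] = -φ ![x, y, z] := by
  have h := φ.map_update_neg ![x, y, z] 0 x
  have hu (v : V) : Function.update ![x, y, z] 0 v = ![v, y, z] := by
    ext i : 1; fin_cases i <;> rfl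
  rwa [hu, hu] at h

theorem threeForm_eq_left : φ ![x, x, z] = 0 :=
  φ.map_eq_zero_of_eq _ (i := 0) (j := 1) rfl (by decide)

theorem threeForm_eq_right : φ ![x, y, y] = 0 :=
  φ.map_eq_zero_of_eq _ (i := 1) (j := 2) rfl (by decide)

theorem threeForm_swap_left : φ ![x, y, z] = -φ ![y, x, z] := by
  rw [← φ.map_swap _ (i := 0) (j := 1) (by decide)]
  congr 1; ext i; fin_cases i <;> rfl

theorem threeForm_rotate : φ ![x, y, z] = φ ![y, z, x] := by
  rw [threeForm_swap_left, ← φ.map_swap _ (i := 1) (j := 2) (by decide)]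
  congr 1; ext i; fin_cases i <;> rfl

end ThreeForms

/-- Alternating 3-forms on `V` agreeing on increasing triples of basis vectors are equal. -/
theorem threeForm_ext {φ ψ : AlternatingMap ℝ V ℝ (Fin 3)}
    (h : ∀ i j k : Fin 7, i < j → j < k → φ ![e i, e j, e k] = ψ ![e i, e j, e k]) : φ = ψ := by
  refine (Pi.basisFun ℝ (Fin 7)).ext_alternating fun v hv => ?_
  have hs : StrictMono (v ∘ Tuple.sort v) :=
    (Tuple.monotone_sort v).strictMono_of_injective (hv.comp (Tuple.sort v).injective)
  have key := h _ _ _ (hs (show (0 : Fin 3) < 1 by decide)) (hs (show (1 : Fin 3) < 2 by decide))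
  have hvec : (![e ((v ∘ Tuple.sort v) 0), e ((v ∘ Tuple.sort v) 1), e ((v ∘ Tuple.sort v) 2)] :
      Fin 3 → V) = (fun i => Pi.basisFun ℝ (Fin 7) (v i)) ∘ Tuple.sort v := by
    ext i : 1; fin_cases i <;> simp
  rw [hvec, φ.map_perm, ψ.map_perm] at key
  exact smul_left_cancel _ key

theorem w3_apply (i j k : Fin 7) (x y z : V) :
    w3 i j k ![x, y, z] = x i * y j * z k - x i * y k * z j - x j * y i * z k
      + x j * y k * z i + x k * y i * z j - x k * y j * z i := by
  change Matrix.det (Matrix.of fun a b => ![x, y, z] a (![i, j, k] b)) = _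
  rw [Matrix.det_fin_three]
  simp

theorem w3_single {i j k a b c : Fin 7} (hij : i < j) (hjk : j < k) (hab : a < b) (hbc : b < c) :
    w3 i j k ![e a, e b, e c] = if i = a ∧ j = b ∧ k = c then 1 else 0 := by
  simp only [w3_apply, Pi.single_apply]
  grind

theorem closed3_relations {φ : AlternatingMap ℝ V ℝ (Fin 3)} (h : Closed3 φ) :
    φ ![e 0, e 3, e 5] = φ ![e 1, e 3, e 4] - φ ![e 1, e 2, e 5] ∧
    φ ![e 0, e 4, e 5] = φ ![e 2, e 3, e 4] - φ ![e 1, e 2, e 6] ∧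
    φ ![e 0, e 5, e 6] = φ ![e 1, e 4, e 6] - φ ![e 2, e 4, e 5] ∧
    φ ![e 1, e 3, e 6] = φ ![e 2, e 3, e 5] ∧
    φ ![e 1, e 4, e 5] = φ ![e 2, e 3, e 5] ∧
    φ ![e 1, e 5, e 6] = 0 ∧
    φ ![e 2, e 3, e 6] = φ ![e 2, e 4, e 5] ∧
    φ ![e 2, e 5, e 6] = 0 ∧
    φ ![e 3, e 4, e 5] = 0 ∧
    φ ![e 3, e 4, e 6] = 0 ∧
    φ ![e 3, e 5, e 6] = 0 ∧
    φ ![e 4, e 5, e 6] = 0 := by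
  have swap : ∀ i j k : Fin 7, j < i → φ ![e i, e j, e k] = -φ ![e j, e i, e k] :=
    fun i j k _ => threeForm_swap_left ..
  have rot : ∀ i j k : Fin 7, k < i → j < k → φ ![e i, e j, e k] = φ ![e j, e k, e i] :=
    fun i j k _ _ => threeForm_rotate ..
  have h0123 := h (e 0) (e 1) (e 2) (e 3)
  have h0124 := h (e 0) (e 1) (e 2) (e 4)
  have h0125 := h (e 0) (e 1) (e 2) (e 5)
  have h0126 := h (e 0) (e 1) (e 2) (e 6)
  have h0134 := h (e 0) (e 1) (e 3) (e 4)
  have h0136 := h (e 0) (e 1) (e 3) (e 6)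
  have h0146 := h (e 0) (e 1) (e 4) (e 6)
  have h0156 := h (e 0) (e 1) (e 5) (e 6)
  have h0234 := h (e 0) (e 2) (e 3) (e 4)
  have h0235 := h (e 0) (e 2) (e 3) (e 5)
  have h0245 := h (e 0) (e 2) (e 4) (e 5)
  have h0256 := h (e 0) (e 2) (e 5) (e 6)
  simp [d3, bk_single_single, threeForm_zero_left, threeForm_neg_left, threeForm_eq_left,
    threeForm_eq_right, rot, swap] at *
  refine ⟨?_, ?_, ?_, ?_, ?_, ?_, ?_, ?_, ?_, ?_, ?_, ?_⟩ <;> linarith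

/-- The closed 3-forms on `247L`. -/
def closedForms : Submodule ℝ (AlternatingMap ℝ V ℝ (Fin 3)) where
  carrier := {φ | Closed3 φ}
  zero_mem' := fun _ _ _ _ => by simp [d3]
  add_mem' := fun {φ ψ} hφ hψ a b c d => by
    have h₁ := hφ a b c d
    have h₂ := hψ a b c d
    simp only [d3, AlternatingMap.add_apply] at h₁ h₂ ⊢
    linear_combination h₁ + h₂
  smul_mem' := fun r φ hφ a b c d => by
    have h := hφ a b c d
    simp only [d3, AlternatingMap.smul_apply, smul_eq_mul] at h ⊢
    linear_combination r * h

/-- A basis of the closed 3-forms. -/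
def closedGen : Fin 23 → AlternatingMap ℝ V ℝ (Fin 3) :=
  ![w3 0 1 2, w3 0 1 3, w3 0 1 4, w3 0 1 5, w3 0 1 6, w3 0 2 3, w3 0 2 4, w3 0 2 5, w3 0 2 6,
    w3 0 3 4, w3 0 3 6, w3 0 4 6, w3 1 2 3, w3 1 2 4, w3 1 2 5 - w3 0 3 5, w3 1 2 6 - w3 0 4 5,
    w3 1 3 4 + w3 0 3 5, w3 1 3 5, w3 1 4 6 + w3 0 5 6, w3 2 3 4 + w3 0 4 5,
    w3 2 3 5 + w3 1 3 6 + w3 1 4 5, w3 2 4 5 - w3 0 5 6 + w3 2 3 6, w3 2 4 6]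

/-- The increasing triples complementary to the leading terms of the closedness equations. -/
def freeTriple : Fin 23 → Fin 7 × Fin 7 × Fin 7 :=
  ![(0, 1, 2), (0, 1, 3), (0, 1, 4), (0, 1, 5), (0, 1, 6), (0, 2, 3), (0, 2, 4), (0, 2, 5),
    (0, 2, 6), (0, 3, 4), (0, 3, 6), (0, 4, 6), (1, 2, 3), (1, 2, 4), (1, 2, 5), (1, 2, 6),
    (1, 3, 4), (1, 3, 5), (1, 4, 6), (2, 3, 4), (2, 3, 5), (2, 4, 5), (2, 4, 6)]

theorem closedGen_mem (n : Fin 23) : closedGen n ∈ closedForms := by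
  intro a b c d
  fin_cases n <;>
    simp [closedGen, d3, w3_apply, bk] <;> ring

theorem closedGen_apply (m n : Fin 23) :
    closedGen m ![e (freeTriple n).1, e (freeTriple n).2.1, e (freeTriple n).2.2] =
      if m = n then 1 else 0 := by
  have hlt : (freeTriple n).1 < (freeTriple n).2.1 ∧ (freeTriple n).2.1 < (freeTriple n).2.2 := by
    revert n; decide
  fin_cases m <;> simp [closedGen, w3_single, hlt] <;> clear hlt <;> revert n <;>
    simp [Fin.forall_fin_succ, freeTriple]

/-- Evaluation of closed forms on the free triples of basis vectors. -/
def closedCoord : closedForms →ₗ[ℝ] (Fin 23 → ℝ) where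
  toFun φ n := φ.1 ![e (freeTriple n).1, e (freeTriple n).2.1, e (freeTriple n).2.2]
  map_add' _ _ := rfl
  map_smul' _ _ := rfl

theorem closedCoord_injective : Function.Injective closedCoord := by
  refine (injective_iff_map_eq_zero _).mpr fun ⟨φ, hφ⟩ h => Subtype.ext ?_
  obtain ⟨h₁, h₂, h₃, h₄, h₅, h₆, h₇, h₈, h₉, h₁₀, h₁₁, h₁₂⟩ := closed3_relations hφ
  have hfree (n : Fin 23) :
      φ ![e (freeTriple n).1, e (freeTriple n).2.1, e (freeTriple n).2.2] = 0 := congrFun h n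
  simp [Fin.forall_fin_succ, freeTriple] at hfree
  refine threeForm_ext fun i j k hij hjk => ?_
  fin_cases i <;> fin_cases j <;> first | (exact absurd hij (by decide)) |
    (fin_cases k <;> first | (exact absurd hjk (by decide)) | simp [*])

theorem closedCoord_surjective : Function.Surjective closedCoord := fun c => by
  have hgen (m n : Fin 23) :
      closedCoord ⟨closedGen m, closedGen_mem m⟩ n = if m = n then 1 else 0 := closedGen_apply m n
  refine ⟨∑ m, c m • ⟨closedGen m, closedGen_mem m⟩, ?_⟩
  ext n
  simp only [map_sum, map_smul, Finset.sum_apply, Pi.smul_apply, hgen]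
  simp

theorem finrank_closedForms : Module.finrank ℝ closedForms = 23 := by
  rw [(LinearEquiv.ofBijective _ ⟨closedCoord_injective, closedCoord_surjective⟩).finrank_eq]
  simp

/-- The derivations of `247L`. -/
def derivations : Submodule ℝ (V →ₗ[ℝ] V) where
  carrier := {D | IsDeriv D}
  zero_mem' := fun x y => by ext k; fin_cases k <;> simp [bk]
  add_mem' := fun {D E} hD hE x y => by
    have h := congrArg₂ (· + ·) (hD x y) (hE x y)
    simp only [LinearMap.add_apply] at h ⊢
    rw [h]
    ext k; fin_cases k <;> simp [bk] <;> ring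
  smul_mem' := fun r D hD x y => by
    have h := congrArg (r • ·) (hD x y)
    simp only [LinearMap.smul_apply] at h ⊢
    rw [h]
    ext k; fin_cases k <;> simp [bk] <;> ring

/-- The matrix of the general derivation of `247L`. -/
def derivMatrix (c : Fin 17 → ℝ) : Matrix (Fin 7) (Fin 7) ℝ :=
  !![c 0, 0, 0, 0, 0, 0, 0;
     c 1, c 7, c 12, 0, 0, 0, 0;
     c 2, 0, 2 * c 0, 0, 0, 0, 0;
     c 3, c 8, c 13, c 7 + c 0, c 12, 0, 0;
     c 4, c 9, c 14, 0, 3 * c 0, 0, 0;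
     c 5, c 10, c 15, c 8 - c 2, c 13 + c 1, c 7 + 2 * c 0, c 12;
     c 6, c 11, c 16, c 9, c 14, 0, 4 * c 0]

/-- Positions of the matrix entries that determine a derivation. -/
def freeEntry : Fin 17 → Fin 7 × Fin 7 :=
  ![(0, 0), (1, 0), (2, 0), (3, 0), (4, 0), (5, 0), (6, 0), (1, 1), (3, 1), (4, 1), (5, 1), (6, 1),
    (1, 2), (3, 2), (4, 2), (5, 2), (6, 2)]

theorem isDeriv_derivMatrix (c : Fin 17 → ℝ) : IsDeriv (Matrix.toLin' (derivMatrix c)) := by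
  intro x y
  ext k
  fin_cases k <;>
    simp [derivMatrix, bk, Matrix.mulVec, dotProduct, Fin.sum_univ_succ] <;> ring

theorem IsDeriv.eq_derivMatrix {D : V →ₗ[ℝ] V} (hD : IsDeriv D) :
    D = Matrix.toLin' (derivMatrix fun n => D (e (freeEntry n).2) (freeEntry n).1) := by
  obtain ⟨A, rfl⟩ := Matrix.toLin'.surjective D
  congr 1
  have h01 := hD (e 0) (e 1)
  have h02 := hD (e 0) (e 2)
  have h03 := hD (e 0) (e 3)
  have h04 := hD (e 0) (e 4)
  have h05 := hD (e 0) (e 5)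
  have h12 := hD (e 1) (e 2)
  have h13 := hD (e 1) (e 3)
  have h23 := hD (e 2) (e 3)
  have h14 := hD (e 1) (e 4)
  have h24 := hD (e 2) (e 4)
  have h15 := hD (e 1) (e 5)
  clear hD
  simp [bk_single_single, funext_iff, Fin.forall_fin_succ, Matrix.mulVec_neg] at *
  simp [bk] at *
  ext i j
  fin_cases i <;> fin_cases j <;> simp [derivMatrix, freeEntry] <;> linarith

/-- The entries of a derivation that determine it. -/
def derivCoord : derivations →ₗ[ℝ] (Fin 17 → ℝ) where
  toFun D n := D.1 (e (freeEntry n).2) (freeEntry n).1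
  map_add' _ _ := rfl
  map_smul' _ _ := rfl

theorem derivCoord_injective : Function.Injective derivCoord := fun D E h => by
  apply Subtype.ext
  rw [IsDeriv.eq_derivMatrix D.2, IsDeriv.eq_derivMatrix E.2]
  exact congrArg (fun c => Matrix.toLin' (derivMatrix c)) h

theorem derivCoord_surjective : Function.Surjective derivCoord := fun c => by
  refine ⟨⟨_, isDeriv_derivMatrix c⟩, ?_⟩
  ext n
  fin_cases n <;> simp [derivCoord, derivMatrix, freeEntry]

theorem finrank_derivations : Module.finrank ℝ derivations = 17 := by
  rw [(LinearEquiv.ofBijective _ ⟨derivCoord_injective, derivCoord_surjective⟩).finrank_eq]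
  simp

theorem closed3_phi : Closed3 phi := by
  intro a b c d
  simp [phi, d3, w3_apply, bk]
  ring

theorem phi_apply (x y z : V) :
    phi ![x, y, z] = w3 0 1 2 ![x, y, z] + w3 0 1 5 ![x, y, z] - w3 0 2 6 ![x, y, z]
      - w3 0 3 4 ![x, y, z] - 2 * w3 0 5 6 ![x, y, z] + w3 1 3 5 ![x, y, z]
      - w3 1 4 6 ![x, y, z] + w3 2 3 6 ![x, y, z] + w3 2 4 5 ![x, y, z] :=
  rfl

theorem eq_zero_of_stab3_phi {c : Fin 17 → ℝ} (h : Stab3 phi (Matrix.toLin' (derivMatrix c))) :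
    c = 0 := by
  have h034 := h (e 0) (e 3) (e 4)
  have h123 := h (e 1) (e 2) (e 3)
  have h124 := h (e 1) (e 2) (e 4)
  have h134 := h (e 1) (e 3) (e 4)
  have h136 := h (e 1) (e 3) (e 6)
  have h146 := h (e 1) (e 4) (e 6)
  have h234 := h (e 2) (e 3) (e 4)
  have h013 := h (e 0) (e 1) (e 3)
  have h014 := h (e 0) (e 1) (e 4)
  have h023 := h (e 0) (e 2) (e 3)
  have h024 := h (e 0) (e 2) (e 4)
  have h035 := h (e 0) (e 3) (e 5)
  have h045 := h (e 0) (e 4) (e 5)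
  have h012 := h (e 0) (e 1) (e 2)
  have h016 := h (e 0) (e 1) (e 6)
  have h025 := h (e 0) (e 2) (e 5)
  have h015 := h (e 0) (e 1) (e 5)
  clear h
  simp [phi_apply, w3_apply, derivMatrix] at *
  ext n
  fin_cases n <;> simp <;> linarith

theorem statement_4 :
    (∃ Z : Submodule ℝ (AlternatingMap ℝ V ℝ (Fin 3)),
      (∀ φ, φ ∈ Z ↔ Closed3 φ) ∧ Module.finrank ℝ Z = 23) ∧
    (∃ W : Submodule ℝ (V →ₗ[ℝ] V),
      (∀ D, D ∈ W ↔ IsDeriv D) ∧ Module.finrank ℝ W = 17) ∧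
    Closed3 phi ∧
    (∀ D : V →ₗ[ℝ] V, IsDeriv D → Stab3 phi D → D = 0) := by
  refine ⟨⟨closedForms, fun _ => Iff.rfl, finrank_closedForms⟩,
    ⟨derivations, fun _ => Iff.rfl, finrank_derivations⟩, closed3_phi, fun D hD hS => ?_⟩
  rw [hD.eq_derivMatrix] at hS
  exact congrArg Subtype.val (derivCoord_injective (a₁ := ⟨D, hD⟩) (a₂ := 0)
    (eq_zero_of_stab3_phi hS))
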